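/- A subfamily S of a left-cancellative category C is a Garside family if and only if S♯ generates C and every morphism of C that is a composite of two elements of S♯ admits an S-normal decomposition. -/

import Mathlib

open CategoryTheory

universe u v

namespace GarsideTest

variable {C : Type u} [Category.{v} C]

/-- `C` is left-cancellative. -/
def LeftCancellative (C : Type u) [Category.{v} C] : Prop :=
  ∀ ⦃x y z : C⦄ (f : x ⟶ y) (g g' : y ⟶ z), f ≫ g = f ≫ g' → g = g'

/-- `f` left-divides `g`. -/
def LDiv {x y z : C} (f : x ⟶ y) (g : x ⟶ z) : Prop :=
  ∃ r : y ⟶ z, f ≫ r = g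

/-- `f` properly left-divides `g` (`f ⊏ g`). -/
def LDivStrict {x y z : C} (f : x ⟶ y) (g : x ⟶ z) : Prop :=
  LDiv f g ∧ ¬ LDiv g f

/-- `f =× g` : `g` is obtained from `f` by right-multiplication by an invertible element. -/
def EqIr {x y z : C} (f : x ⟶ y) (g : x ⟶ z) : Prop :=
  ∃ e : y ⟶ z, IsIso e ∧ f ≫ e = g

/-- The family `S♯ = S C× ∪ C×`. -/
def Sharp (S : MorphismProperty C) : MorphismProperty C :=
  fun x z g =>
    (∃ (y : C) (s : x ⟶ y) (e : y ⟶ z), S s ∧ IsIso e ∧ s ≫ e = g) ∨ IsIso g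

/-- Composable paths of morphisms of `C`. -/
inductive Path {C : Type u} [Category.{v} C] : C → C → Type (max u v)
  | nil (x : C) : Path x x
  | cons {x y z : C} (g : x ⟶ y) (p : Path y z) : Path x z

namespace Path

/-- The composite of a path. -/
def comp : ∀ {x z : C}, Path x z → (x ⟶ z)
  | _, _, nil x => 𝟙 x
  | _, _, cons g p => g ≫ p.comp

/-- The length of a path. -/
def length : ∀ {x z : C}, Path x z → ℕ
  | _, _, nil _ => 0
  | _, _, cons _ p => p.length + 1

/-- All entries of the path lie in `T`. -/
def Entries (T : MorphismProperty C) : ∀ {x z : C}, Path x z → Prop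
  | _, _, nil _ => True
  | _, _, cons g p => T g ∧ Entries T p

/-- Concatenation of paths. -/
def append : ∀ {x y z : C}, Path x y → Path y z → Path x z
  | _, _, _, nil _, q => q
  | _, _, _, cons g p, q => cons g (p.append q)

open scoped Classical in
/-- Number of non-invertible entries of a path. -/
noncomputable def ninv : ∀ {x z : C}, Path x z → ℕ
  | _, _, nil _ => 0
  | _, _, cons g p => (if IsIso g then 0 else 1) + p.ninv

end Path

/-- The length-two path `(g₁, g₂)` is `S`-greedy. -/
def Greedy2 (S : MorphismProperty C) {x y z : C} (g₁ : x ⟶ y) (g₂ : y ⟶ z) : Prop :=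
  ∀ ⦃u w : C⦄ (f : u ⟶ x) (h : u ⟶ w), S h → LDiv h (f ≫ g₁ ≫ g₂) → LDiv h (f ≫ g₁)

/-- Auxiliary: the path `g :: p` is `S`-greedy. -/
def Path.GreedyFrom (S : MorphismProperty C) : ∀ {x y z : C}, (x ⟶ y) → Path y z → Prop
  | _, _, _, _, .nil _ => True
  | _, _, _, g, .cons g' p => Greedy2 S g g' ∧ Path.GreedyFrom S g' p

/-- The path `p` is `S`-greedy. -/
def Path.Greedy (S : MorphismProperty C) : ∀ {x z : C}, Path x z → Prop
  | _, _, .nil _ => True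
  | _, _, .cons g p => Path.GreedyFrom S g p

/-- The path `p` is `S`-normal: `S`-greedy with entries in `S♯`. -/
def Path.Normal (S : MorphismProperty C) {x z : C} (p : Path x z) : Prop :=
  p.Greedy S ∧ p.Entries (Sharp S)

/-- `p` is an `S`-normal decomposition of the morphism `g`. -/
def IsNormalDecomp (S : MorphismProperty C) {x z : C} (g : x ⟶ z) (p : Path x z) : Prop :=
  p.Normal S ∧ p.comp = g

/-- `X` generates `C`. -/
def Generates (X : MorphismProperty C) : Prop :=
  ∀ ⦃x z : C⦄ (g : x ⟶ z), ∃ p : Path x z, p.Entries X ∧ p.comp = g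

/-- `S` is a Garside family in `C`. -/
def IsGarside (S : MorphismProperty C) : Prop :=
  ∀ ⦃x z : C⦄ (g : x ⟶ z), ∃ p : Path x z, IsNormalDecomp S g p

/-- `Xʳ`: morphisms expressible as composites of `r` elements of `X`. -/
def MPow (X : MorphismProperty C) (r : ℕ) : MorphismProperty C :=
  fun x z g => ∃ p : Path x z, p.Entries X ∧ p.length = r ∧ p.comp = g

/-- `X` is closed under right-complement. -/
def ClosedUnderRightComplement (X : MorphismProperty C) : Prop :=
  ∀ ⦃x y y' z : C⦄ (f : x ⟶ y) (g : x ⟶ y') (h : x ⟶ z), X f → X g →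
    LDiv f h → LDiv g h →
    ∃ (w : C) (g' : y ⟶ w) (f' : y' ⟶ w),
      X g' ∧ X f' ∧ f ≫ g' = g ≫ f' ∧ LDiv (f ≫ g') h

/-- `X` is closed under right-comultiple. -/
def ClosedUnderRightComultiple (X : MorphismProperty C) : Prop :=
  ∀ ⦃x y y' z : C⦄ (f : x ⟶ y) (g : x ⟶ y') (h : x ⟶ z), X f → X g →
    LDiv f h → LDiv g h →
    ∃ (w : C) (h' : x ⟶ w), X h' ∧ LDiv f h' ∧ LDiv g h' ∧ LDiv h' h

/-- `X` is closed under right-divisor. -/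
def ClosedUnderRightDivisor (X : MorphismProperty C) : Prop :=
  ∀ ⦃x y z : C⦄ (f : x ⟶ y) (g : y ⟶ z), X (f ≫ g) → X g

/-- `g₁` is an `S`-head of `g`. -/
def IsHead (S : MorphismProperty C) {x w y : C} (g₁ : x ⟶ w) (g : x ⟶ y) : Prop :=
  S g₁ ∧ LDiv g₁ g ∧ ∀ ⦃w' : C⦄ (h : x ⟶ w'), S h → LDiv h g → LDiv h g₁

/-- `h` is a right-lcm of `f` and `g`. -/
def IsRightLcm {x y y' w : C} (f : x ⟶ y) (g : x ⟶ y') (h : x ⟶ w) : Prop :=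
  LDiv f h ∧ LDiv g h ∧ ∀ ⦃w' : C⦄ (h' : x ⟶ w'), LDiv f h' → LDiv g h' → LDiv h h'

/-- `X` is closed under right-lcm. -/
def ClosedUnderRightLcm (X : MorphismProperty C) : Prop :=
  ∀ ⦃x y y' w : C⦄ (f : x ⟶ y) (g : x ⟶ y') (h : x ⟶ w), X f → X g →
    IsRightLcm f g h → X h

/-- `C` is right-Noetherian: proper right-divisibility is well-founded. -/
def RightNoetherian (C : Type u) [Category.{v} C] : Prop :=
  WellFounded (fun a b : Σ (x : C) (y : C), x ⟶ y =>
    ∃ (e : a.2.1 = b.2.1) (g' : b.1 ⟶ a.1), ¬ IsIso g' ∧ g' ≫ a.2.2 ≫ eqToHom e = b.2.2)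

/-- `C` is left-Noetherian: proper left-divisibility is well-founded. -/
def LeftNoetherian (C : Type u) [Category.{v} C] : Prop :=
  WellFounded (fun a b : Σ (x : C) (y : C), x ⟶ y =>
    ∃ (e : b.1 = a.1) (g' : a.2.1 ⟶ b.2.1), ¬ IsIso g' ∧ eqToHom e ≫ a.2.2 ≫ g' = b.2.2)

/-- `g` is an atom of `C`. -/
def IsAtomMor {x y : C} (g : x ⟶ y) : Prop :=
  ¬ IsIso g ∧ ∀ ⦃w : C⦄ (f : x ⟶ w) (h : w ⟶ y), f ≫ h = g → IsIso f ∨ IsIso h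

/-- The only invertible morphisms of `C` are identities. -/
def NoNontrivialInvertible (C : Type u) [Category.{v} C] : Prop :=
  ∀ ⦃x y : C⦄ (e : x ⟶ y), IsIso e → ∃ h : x = y, e = eqToHom h

/-- Deformation by invertible elements, with a connecting morphism `e` at the left end. -/
inductive DeformRel : ∀ {xf xg z : C}, (xf ⟶ xg) → Path xf z → Path xg z → Prop
  | nil (z : C) : DeformRel (𝟙 z) (.nil z) (.nil z)
  | cons {xf xg yf yg z : C} (e : xf ⟶ xg) (f : xf ⟶ yf) (g : xg ⟶ yg) (e' : yf ⟶ yg)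
      {p : Path yf z} {q : Path yg z} :
      IsIso e' → e ≫ g = f ≫ e' → DeformRel e' p q →
      DeformRel e (.cons f p) (.cons g q)
  | padF {xg yg z : C} (e : z ⟶ xg) (g : xg ⟶ yg) (e' : z ⟶ yg) {q : Path yg z} :
      IsIso e' → e ≫ g = e' → DeformRel e' (.nil z) q →
      DeformRel e (.nil z) (.cons g q)
  | padG {xf yf z : C} (e : xf ⟶ z) (f : xf ⟶ yf) (e' : yf ⟶ z) {p : Path yf z} :
      IsIso e' → e = f ≫ e' → DeformRel e' p (.nil z) →
      DeformRel e (.cons f p) (.nil z)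

/-- `p` is a `C×`-deformation of `q`. -/
def IsDeformation {x z : C} (p q : Path x z) : Prop :=
  DeformRel (𝟙 x) p q

theorem Sharp.comp_iso {S : MorphismProperty C} {x y z : C} {s : x ⟶ y} {e : y ⟶ z}
    (hs : Sharp S s) (he : IsIso e) : Sharp S (s ≫ e) := by
  rcases hs with ⟨w, t, e', ht, he', rfl⟩ | hs
  · exact .inl ⟨w, t, e' ≫ e, ht, inferInstance, by simp⟩
  · exact .inr inferInstance

theorem LDiv.trans_comp {x y z w : C} {f : x ⟶ y} {g : x ⟶ z} (h : LDiv f g) (r : z ⟶ w) :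
    LDiv f (g ≫ r) := by
  obtain ⟨t, rfl⟩ := h
  exact ⟨t ≫ r, by simp⟩

/-- Greediness with respect to `S` implies greediness with respect to `S♯`. -/
theorem Greedy2.ldiv_of_sharp {S : MorphismProperty C} {x y z : C} {g₁ : x ⟶ y} {g₂ : y ⟶ z}
    (hg : Greedy2 S g₁ g₂) {u w : C} (f : u ⟶ x) {h : u ⟶ w} (hh : Sharp S h)
    (hd : LDiv h (f ≫ g₁ ≫ g₂)) : LDiv h (f ≫ g₁) := by
  rcases hh with ⟨v, s, e, hs, he, rfl⟩ | hh
  · obtain ⟨t, ht⟩ := hd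
    obtain ⟨r, hr⟩ := hg f s hs ⟨e ≫ t, by simpa using ht⟩
    exact ⟨inv e ≫ r, by simpa using hr⟩
  · exact ⟨inv h ≫ f ≫ g₁, by simp⟩

/-- An element of `S♯` left-dividing `f` followed by an `S`-greedy path left-divides `f` followed
by the first entry of that path. -/
theorem Path.GreedyFrom.ldiv_of_sharp {S : MorphismProperty C} {x y z : C} {g : x ⟶ y}
    {p : Path y z} (hp : Path.GreedyFrom S g p) {u w : C} (f : u ⟶ x) {h : u ⟶ w}
    (hh : Sharp S h) (hd : LDiv h (f ≫ g ≫ p.comp)) : LDiv h (f ≫ g) := by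
  induction p generalizing x with
  | nil => simpa [Path.comp] using hd
  | cons g₂ p ih =>
    refine hp.1.ldiv_of_sharp f hh ?_
    simpa using ih hp.2 (f ≫ g) (by simpa [Path.comp] using hd)

theorem Greedy2.comp_iso {S : MorphismProperty C} {x y z w : C} {g₁ : x ⟶ y} {g₂ : y ⟶ z}
    (hg : Greedy2 S g₁ g₂) {e : z ⟶ w} (he : IsIso e) : Greedy2 S g₁ (g₂ ≫ e) :=
  fun _ _ f h hh hd => hg f h hh (by simpa using hd.trans_comp (inv e))

theorem greedy2_id (S : MorphismProperty C) {x y : C} (g : x ⟶ y) : Greedy2 S g (𝟙 y) :=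
  fun _ _ f h _ hd => by simpa using hd

/-- In a left-cancellative category, a right inverse is an inverse. -/
theorem LeftCancellative.isIso_of_comp_eq_id (hC : LeftCancellative C) {x y : C} {r : x ⟶ y}
    {t : y ⟶ x} (h : r ≫ t = 𝟙 x) : IsIso t :=
  ⟨r, hC r _ _ (by rw [← Category.assoc, h]; simp), h⟩

/-- If the composite of two elements of `S♯` has an `S`-normal decomposition, it has one of
length two. -/
theorem LeftCancellative.exists_greedy2_of_isNormalDecomp (hC : LeftCancellative C)
    {S : MorphismProperty C} {x y z : C} {s₁ : x ⟶ y} {s₂ : y ⟶ z} (h₁ : Sharp S s₁)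
    (h₂ : Sharp S s₂) {p : Path x z} (hp : IsNormalDecomp S (s₁ ≫ s₂) p) :
    ∃ (w : C) (g₁ : x ⟶ w) (g₂ : w ⟶ z),
      Sharp S g₁ ∧ Sharp S g₂ ∧ Greedy2 S g₁ g₂ ∧ g₁ ≫ g₂ = s₁ ≫ s₂ := by
  obtain ⟨⟨hgr, hent⟩, hcomp⟩ := hp
  cases p with
  | nil =>
    exact ⟨x, 𝟙 x, 𝟙 x, .inr inferInstance, .inr inferInstance, greedy2_id S _,
      by simpa [Path.comp] using hcomp⟩
  | cons g₁ p =>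
    cases p with
    | nil =>
      exact ⟨z, g₁, 𝟙 z, hent.1, .inr inferInstance, greedy2_id S _,
        by simpa [Path.comp] using hcomp⟩
    | cons g₂ p =>
      simp only [Path.comp] at hcomp
      obtain ⟨t, ht⟩ : LDiv s₁ g₁ := by
        simpa using Path.GreedyFrom.ldiv_of_sharp hgr (𝟙 x) h₁
          ⟨s₂, by simpa [Path.comp] using hcomp.symm⟩
      have hs₂ : t ≫ g₂ ≫ p.comp = s₂ :=
        hC s₁ _ _ (by rw [← hcomp, ← ht, Category.assoc])
      obtain ⟨r, hr⟩ : LDiv s₂ (t ≫ g₂) :=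
        Path.GreedyFrom.ldiv_of_sharp hgr.2 t h₂ ⟨𝟙 z, by simpa using hs₂.symm⟩
      have hiso : IsIso p.comp := hC.isIso_of_comp_eq_id (r := r) <| hC s₂ _ _ <| by
        rw [← Category.assoc, hr, Category.assoc, hs₂, Category.comp_id]
      exact ⟨_, g₁, g₂ ≫ p.comp, hent.1, hent.2.1.comp_iso hiso, hgr.1.comp_iso hiso, hcomp⟩

/-- The domino rule. -/
theorem Greedy2.domino {S : MorphismProperty C} {x y z x' y' z' : C} {g₁ : x ⟶ y} {g₂ : y ⟶ z}
    {g₁' : x' ⟶ y'} {g₂' : y' ⟶ z'} {t₀ : x' ⟶ x} {t₁ : y' ⟶ y} {t₂ : z' ⟶ z}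
    (hg : Greedy2 S g₁ g₂) (hg' : Greedy2 S g₁' t₁) (e₁ : g₁' ≫ t₁ = t₀ ≫ g₁)
    (e₂ : g₂' ≫ t₂ = t₁ ≫ g₂) : Greedy2 S g₁' g₂' := by
  intro u w f h hh hd
  refine hg' f h hh ?_
  have h₁ : LDiv h ((f ≫ t₀) ≫ g₁ ≫ g₂) := by
    have := hd.trans_comp t₂
    rwa [Category.assoc, Category.assoc, e₂, reassoc_of% e₁, ← Category.assoc] at this
  simpa [e₁] using hg (f ≫ t₀) h hh h₁

/-- Every composite of two elements of `S♯` has an `S`-normal decomposition of length two. -/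
def HasSquareDecomp (S : MorphismProperty C) : Prop :=
  ∀ ⦃x y z : C⦄ (s₁ : x ⟶ y) (s₂ : y ⟶ z), Sharp S s₁ → Sharp S s₂ →
    ∃ (w : C) (g₁ : x ⟶ w) (g₂ : w ⟶ z),
      Sharp S g₁ ∧ Sharp S g₂ ∧ Greedy2 S g₁ g₂ ∧ g₁ ≫ g₂ = s₁ ≫ s₂

theorem HasSquareDecomp.exists_greedyFrom_comp_eq {S : MorphismProperty C} (hS : HasSquareDecomp S)
    {x y z x' y' : C} {g : x ⟶ y} {p : Path y z}
    (hp : Path.GreedyFrom S g p) (hent : p.Entries (Sharp S)) {t₀ : x' ⟶ x} {g' : x' ⟶ y'}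
    {t : y' ⟶ y} (ht : Sharp S t) (hg' : Greedy2 S g' t) (e : g' ≫ t = t₀ ≫ g) :
    ∃ q : Path y' z, q.Entries (Sharp S) ∧ Path.GreedyFrom S g' q ∧ q.comp = t ≫ p.comp := by
  induction p generalizing x x' y' with
  | nil => exact ⟨.cons t (.nil _), ⟨ht, trivial⟩, ⟨hg', trivial⟩, rfl⟩
  | cons g₂ p ih =>
    obtain ⟨w, g₂', t₂, hg₂', ht₂, hgr, e₂⟩ := hS t g₂ ht hent.1
    obtain ⟨q, hq, hqg, hqc⟩ := ih hp.2 hent.2 ht₂ hgr e₂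
    refine ⟨.cons g₂' q, ⟨hg₂', hq⟩, ⟨hp.1.domino hg' e e₂, hqg⟩, ?_⟩
    simp only [Path.comp, hqc]
    rw [reassoc_of% e₂]

theorem HasSquareDecomp.exists_isNormalDecomp_comp {S : MorphismProperty C} (hS : HasSquareDecomp S)
    {x y z : C} {s : x ⟶ y} (hs : Sharp S s) {p : Path y z}
    (hp : p.Normal S) : ∃ q : Path x z, IsNormalDecomp S (s ≫ p.comp) q := by
  cases p with
  | nil => exact ⟨.cons s (.nil _), ⟨trivial, hs, trivial⟩, rfl⟩
  | cons g p =>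
    obtain ⟨w, g', t, hg', ht, hgr, e⟩ := hS s g hs hp.2.1
    obtain ⟨q, hq, hqg, hqc⟩ := hS.exists_greedyFrom_comp_eq hp.1 hp.2.2 ht hgr e
    refine ⟨.cons g' q, ⟨hqg, hg', hq⟩, ?_⟩
    simp only [Path.comp, hqc]
    rw [reassoc_of% e]

theorem HasSquareDecomp.exists_isNormalDecomp {S : MorphismProperty C} (hS : HasSquareDecomp S)
    {x z : C} (p : Path x z) (hp : p.Entries (Sharp S)) :
    ∃ q : Path x z, IsNormalDecomp S p.comp q := by
  induction p with
  | nil x => exact ⟨.nil x, ⟨trivial, trivial⟩, rfl⟩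
  | cons g p ih =>
    obtain ⟨q, hq, hqc⟩ := ih hp.2
    simpa only [Path.comp, hqc] using hS.exists_isNormalDecomp_comp hp.1 hq

theorem stmt9 {C : Type u} [Category.{v} C] (hC : LeftCancellative C)
    (S : MorphismProperty C) :
    IsGarside S ↔
      (Generates (Sharp S) ∧
        ∀ ⦃x z : C⦄ (g : x ⟶ z), MPow (Sharp S) 2 g →
          ∃ p : Path x z, IsNormalDecomp S g p) := by
  constructor
  · refine fun h => ⟨fun x z g => ?_, fun x z g _ => h g⟩
    obtain ⟨p, hp, hc⟩ := h g
    exact ⟨p, hp.2, hc⟩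
  · rintro ⟨hgen, hsq⟩ x z g
    have hS : HasSquareDecomp S := fun x y z s₁ s₂ h₁ h₂ => by
      obtain ⟨p, hp⟩ := hsq (s₁ ≫ s₂)
        ⟨.cons s₁ (.cons s₂ (.nil _)), ⟨h₁, h₂, trivial⟩, rfl, by simp [Path.comp]⟩
      exact hC.exists_greedy2_of_isNormalDecomp h₁ h₂ hp
    obtain ⟨p, hp, rfl⟩ := hgen g
    exact hS.exists_isNormalDecomp p hp

end GarsideTest
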